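/- arXiv:2309.02007 — 9 statements merged into one kernel-verified Lean document; each statement's English description precedes it below -/
import Mathlib

section
/- For every x ∈ G, the set { c ∈ ]-∞, M[ : f(x+h) ≤ c ⊞ b(h) for all h ∈ Db } is nonempty and bounded below, its infimum is attained, and c1_b(f)(x) = max_{h ∈ Db} ( f(x+h) ⊟ b(h) ); i.e., the map of the least upper bounds equals the finite maximum over h ∈ Db of the LIP-differences f(x+h) ⊟ b(h). -/
/-- LIP-addition: a ⊞ b = a + b - a·b/M. -/
noncomputable def lipAdd (M a b : ℝ) : ℝ := a + b - a * b / M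

/-- LIP-difference (defined when b < M): a ⊟ b = M·(a - b)/(M - b). -/
noncomputable def lipSub (M a b : ℝ) : ℝ := M * (a - b) / (M - b)

/-- LIP-erosion of f by a structuring function a with support Da:
ε_a(f)(x) = min_{h ∈ Da} ( f(x+h) ⊟ a(h) ). -/
noncomputable def lipErosion (M : ℝ) {G : Type*} [AddCommGroup G]
    (Da : Finset G) (hne : Da.Nonempty) (a f : G → ℝ) (x : G) : ℝ :=
  Da.inf' hne fun h => lipSub M (f (x + h)) (a h)

/-- LIP-dilation of f by a structuring function a with support Da:
δ_a(f)(x) = max_{h ∈ Da} ( f(x−h) ⊞ a(h) ). -/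
noncomputable def lipDilation (M : ℝ) {G : Type*} [AddCommGroup G]
    (Da : Finset G) (hne : Da.Nonempty) (a f : G → ℝ) (x : G) : ℝ :=
  Da.sup' hne fun h => lipAdd M (f (x - h)) (a h)

theorem lipSub_le_iff_le_lipAdd {M a b c : ℝ} (hM : 0 < M) (hb : b < M) :
    lipSub M a b ≤ c ↔ a ≤ lipAdd M c b := by
  have key : lipAdd M c b - a = (c * (M - b) - M * (a - b)) / M := by
    unfold lipAdd
    field_simp
    ring
  rw [lipSub, div_le_iff₀ (sub_pos.2 hb), ← sub_nonneg, ← sub_nonneg (b := a), key]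
  simp [div_nonneg_iff, hM.le, hM.not_ge]

theorem lipSub_lt {M a b : ℝ} (hM : 0 < M) (ha : a < M) (hb : b < M) : lipSub M a b < M := by
  rw [lipSub, div_lt_iff₀ (sub_pos.2 hb)]
  gcongr

/-- the set { c < M : ∀ h ∈ Db, f(x+h) ≤ c ⊞ b(h) } is nonempty,
bounded below, its infimum is attained, and the map of the least upper bounds
c1_b(f)(x) = inf of this set equals max_{h ∈ Db} ( f(x+h) ⊟ b(h) ). -/
theorem mlub_eq_max_lipSub (M : ℝ) (hM : 0 < M) {G : Type*} [AddCommGroup G]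
    (Db : Finset G) (hne : Db.Nonempty) (b : G → ℝ) (hb : ∀ h ∈ Db, b h < M)
    (f : G → ℝ) (hf : ∀ x, f x < M) (x : G) :
    let S : Set ℝ := {c | c < M ∧ ∀ h ∈ Db, f (x + h) ≤ lipAdd M c (b h)}
    S.Nonempty ∧ BddBelow S ∧ sInf S ∈ S ∧
    sInf S = Db.sup' hne (fun h => lipSub M (f (x + h)) (b h)) := by
  intro S
  have hleast : IsLeast S (Db.sup' hne fun h => lipSub M (f (x + h)) (b h)) := by
    refine ⟨⟨?_, fun h hh => ?_⟩, fun c hc => ?_⟩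
    · exact (Finset.sup'_lt_iff hne).2 fun h hh => lipSub_lt hM (hf _) (hb h hh)
    · exact (lipSub_le_iff_le_lipAdd hM (hb h hh)).1
        (Finset.le_sup' (fun h => lipSub M (f (x + h)) (b h)) hh)
    · exact Finset.sup'_le hne _ fun h hh =>
        (lipSub_le_iff_le_lipAdd hM (hb h hh)).2 (hc.2 h hh)
  exact ⟨hleast.nonempty, hleast.bddBelow, hleast.csInf_mem, hleast.csInf_eq⟩
end

section
/- For every x ∈ G, the set { c ∈ ]-∞, M[ : c ⊞ b(h) ≤ f(x+h) for all h ∈ Db } is nonempty and bounded above, its supremum is attained, and c2_b(f)(x) = min_{h ∈ Db} ( f(x+h) ⊟ b(h) ) = ε_b(f)(x); i.e., the map of the greatest lower bounds equals the LIP-erosion of f by b. -/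
theorem lipAdd_le_iff_le_lipSub {M a b c : ℝ} (hM : 0 < M) (hb : b < M) :
    lipAdd M c b ≤ a ↔ c ≤ lipSub M a b := by
  have h : M * lipAdd M c b = c * (M - b) + M * b := by
    rw [lipAdd]
    field_simp
    ring
  rw [lipSub, le_div_iff₀ (sub_pos.2 hb), ← mul_le_mul_iff_right₀ hM, h, mul_sub M a b,
    le_sub_iff_add_le]

/-- the set { c < M : ∀ h ∈ Db, c ⊞ b(h) ≤ f(x+h) } is nonempty,
bounded above, its supremum is attained, and the map of the greatest lower
bounds c2_b(f)(x) = sup of this set equals min_{h ∈ Db} ( f(x+h) ⊟ b(h) ),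
i.e. the LIP-erosion ε_b(f)(x). -/
theorem mglb_eq_lipErosion (M : ℝ) (hM : 0 < M) {G : Type*} [AddCommGroup G]
    (Db : Finset G) (hne : Db.Nonempty) (b : G → ℝ) (hb : ∀ h ∈ Db, b h < M)
    (f : G → ℝ) (hf : ∀ x, f x < M) (x : G) :
    let T : Set ℝ := {c | c < M ∧ ∀ h ∈ Db, lipAdd M c (b h) ≤ f (x + h)}
    T.Nonempty ∧ BddAbove T ∧ sSup T ∈ T ∧
    sSup T = Db.inf' hne (fun h => lipSub M (f (x + h)) (b h)) ∧
    sSup T = lipErosion M Db hne b f x := by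
  intro T
  have hT : IsGreatest T (lipErosion M Db hne b f x) := by
    refine ⟨⟨?_, fun h hh => ?_⟩, fun c hc => ?_⟩
    · obtain ⟨h, hh⟩ := hne
      exact (Finset.inf'_le _ hh).trans_lt (lipSub_lt hM (hf _) (hb h hh))
    · exact (lipAdd_le_iff_le_lipSub hM (hb h hh)).2 (Finset.inf'_le _ hh)
    · exact Finset.le_inf' _ _ fun h hh => (lipAdd_le_iff_le_lipSub hM (hb h hh)).1 (hc.2 h hh)
  exact ⟨hT.nonempty, hT.bddAbove, hT.csSup_mem, hT.csSup_eq, hT.csSup_eq⟩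
end

section
/- Let ⊟b̄ denote the structuring function h ↦ 0 ⊟ b(−h) with support −Db = { −h : h ∈ Db }. Then for every x ∈ G: c1_b(f)(x) = δ_{⊟b̄}(f)(x), c2_b(f)(x) = ε_b(f)(x), and the map of LIP-additive Asplund distances satisfies Asp_b(f)(x) = δ_{⊟b̄}(f)(x) ⊟ ε_b(f)(x); i.e., the map of Asplund distances equals the LIP-dilation of f by ⊟b̄ LIP-minus the LIP-erosion of f by b. -/
theorem lipAdd_eq {M : ℝ} (hM : M ≠ 0) (c b : ℝ) : lipAdd M c b = c * (M - b) / M + b := by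
  unfold lipAdd
  field_simp
  ring

theorem le_lipAdd_iff {M b : ℝ} (hM : 0 < M) (hb : b < M) (a c : ℝ) :
    a ≤ lipAdd M c b ↔ lipSub M a b ≤ c := by
  rw [lipAdd_eq hM.ne', ← sub_le_iff_le_add, le_div_iff₀ hM, lipSub, div_le_iff₀ (sub_pos.2 hb),
    mul_comm M]

theorem lipAdd_le_iff {M b : ℝ} (hM : 0 < M) (hb : b < M) (a c : ℝ) :
    lipAdd M c b ≤ a ↔ c ≤ lipSub M a b := by
  rw [lipAdd_eq hM.ne', ← le_sub_iff_add_le, div_le_iff₀ hM, lipSub, le_div_iff₀ (sub_pos.2 hb),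
    mul_comm M]

theorem lipAdd_lipSub_zero {M b : ℝ} (hM : 0 < M) (hb : b < M) (a : ℝ) :
    lipAdd M a (lipSub M 0 b) = lipSub M a b := by
  have hMb : M - b ≠ 0 := (sub_pos.2 hb).ne'
  unfold lipAdd lipSub
  field_simp
  ring

/-- The LIP-dilation by the reflected LIP-negation of `b` is a maximum of LIP-differences. -/
theorem lipDilation_neg_eq_sup' {M : ℝ} (hM : 0 < M) {G : Type*} [AddCommGroup G] [DecidableEq G]
    {D : Finset G} (hne : D.Nonempty) {b : G → ℝ} (hb : ∀ h ∈ D, b h < M) (f : G → ℝ) (x : G) :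
    lipDilation M (D.image fun h => -h) (hne.image _) (fun h => lipSub M 0 (b (-h))) f x =
      D.sup' hne fun h => lipSub M (f (x + h)) (b h) := by
  rw [lipDilation, Finset.sup'_image]
  refine Finset.sup'_congr hne rfl fun h hh => ?_
  simp only [Function.comp_apply, sub_neg_eq_add, neg_neg]
  exact lipAdd_lipSub_zero hM (hb h hh) _

theorem isLeast_upperBounds_lipAdd {M : ℝ} (hM : 0 < M) {G : Type*} [AddCommGroup G]
    {D : Finset G} (hne : D.Nonempty) {b f : G → ℝ} (hb : ∀ h ∈ D, b h < M) (hf : ∀ x, f x < M)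
    (x : G) :
    IsLeast {c | c < M ∧ ∀ h ∈ D, f (x + h) ≤ lipAdd M c (b h)}
      (D.sup' hne fun h => lipSub M (f (x + h)) (b h)) := by
  refine ⟨⟨(Finset.sup'_lt_iff hne).2 fun h hh => lipSub_lt hM (hf _) (hb h hh), fun h hh => ?_⟩,
    fun c hc => Finset.sup'_le hne _ fun h hh => (le_lipAdd_iff hM (hb h hh) _ _).1 (hc.2 h hh)⟩
  exact (le_lipAdd_iff hM (hb h hh) _ _).2
    (Finset.le_sup' (fun h => lipSub M (f (x + h)) (b h)) hh)

theorem isGreatest_lowerBounds_lipAdd {M : ℝ} (hM : 0 < M) {G : Type*} [AddCommGroup G]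
    {D : Finset G} (hne : D.Nonempty) {b f : G → ℝ} (hb : ∀ h ∈ D, b h < M) (hf : ∀ x, f x < M)
    (x : G) :
    IsGreatest {c | c < M ∧ ∀ h ∈ D, lipAdd M c (b h) ≤ f (x + h)} (lipErosion M D hne b f x) := by
  refine ⟨⟨(Finset.inf'_lt_iff hne).2 ?_, fun h hh => ?_⟩,
    fun c hc => Finset.le_inf' hne _ fun h hh => (lipAdd_le_iff hM (hb h hh) _ _).1 (hc.2 h hh)⟩
  · obtain ⟨h, hh⟩ := hne
    exact ⟨h, hh, lipSub_lt hM (hf _) (hb h hh)⟩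
  · exact (lipAdd_le_iff hM (hb h hh) _ _).2
      (Finset.inf'_le (fun h => lipSub M (f (x + h)) (b h)) hh)

/-- with ⊟b̄ the structuring function h ↦ 0 ⊟ b(−h) on −Db,
the map of the least upper bounds c1_b(f)(x) equals the LIP-dilation
δ_{⊟b̄}(f)(x), the map of the greatest lower bounds c2_b(f)(x) equals the
LIP-erosion ε_b(f)(x), and the map of LIP-additive Asplund distances satisfies
Asp_b(f)(x) = δ_{⊟b̄}(f)(x) ⊟ ε_b(f)(x). -/
theorem aspMap_eq_lipDilation_lipSub_lipErosion (M : ℝ) (hM : 0 < M)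
    {G : Type*} [AddCommGroup G] [DecidableEq G]
    (Db : Finset G) (hne : Db.Nonempty) (b : G → ℝ) (hb : ∀ h ∈ Db, b h < M)
    (f : G → ℝ) (hf : ∀ x, f x < M) (x : G) :
    let bbar : G → ℝ := fun h => lipSub M 0 (b (-h))
    let negDb : Finset G := Db.image (fun h => -h)
    let c1 : ℝ := sInf {c | c < M ∧ ∀ h ∈ Db, f (x + h) ≤ lipAdd M c (b h)}
    let c2 : ℝ := sSup {c | c < M ∧ ∀ h ∈ Db, lipAdd M c (b h) ≤ f (x + h)}
    c1 = lipDilation M negDb (hne.image _) bbar f x ∧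
    c2 = lipErosion M Db hne b f x ∧
    lipSub M c1 c2 =
      lipSub M (lipDilation M negDb (hne.image _) bbar f x)
        (lipErosion M Db hne b f x) := by
  intro bbar negDb c1 c2
  have h₁ : c1 = lipDilation M negDb (hne.image _) bbar f x :=
    (isLeast_upperBounds_lipAdd hM hne hb hf x).csInf_eq.trans
      (lipDilation_neg_eq_sup' hM hne hb f x).symm
  have h₂ : c2 = lipErosion M Db hne b f x :=
    (isGreatest_lowerBounds_lipAdd hM hne hb hf x).csSup_eq
  exact ⟨h₁, h₂, by rw [h₁, h₂]⟩
end

section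
/- For every constant k < M, the LIP-additive Asplund distance between f and f ⊞ k is zero: d(f, f ⊞ k) = 0, where (f ⊞ k)(h) = f(h) ⊞ k pointwise. -/
theorem lipAdd_sub_self {M : ℝ} (hM : 0 < M) (a b c : ℝ) (hc : c < M) :
    lipAdd M a (lipAdd M b c) - b =
      (M - b) * ((M - c) / M * ((a - lipSub M 0 c) / M)) := by
  have h : M - c ≠ 0 := (sub_pos.2 hc).ne'
  unfold lipAdd lipSub
  field_simp
  ring

theorem lipSub_zero_lt {M : ℝ} (hM : 0 < M) {c : ℝ} (hc : c < M) : lipSub M 0 c < M := by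
  unfold lipSub
  rw [div_lt_iff₀ (sub_pos.2 hc)]
  nlinarith

theorem le_lipAdd_lipAdd_iff {M : ℝ} (hM : 0 < M) {a b c : ℝ} (hb : b < M) (hc : c < M) :
    b ≤ lipAdd M a (lipAdd M b c) ↔ lipSub M 0 c ≤ a := by
  have hc' : 0 < (M - c) / M := div_pos (sub_pos.2 hc) hM
  rw [← sub_nonneg, lipAdd_sub_self hM a b c hc, mul_nonneg_iff_of_pos_left (sub_pos.2 hb),
    mul_nonneg_iff_of_pos_left hc', le_div_iff₀ hM, zero_mul, sub_nonneg]

theorem lipAdd_lipAdd_le_iff {M : ℝ} (hM : 0 < M) {a b c : ℝ} (hb : b < M) (hc : c < M) :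
    lipAdd M a (lipAdd M b c) ≤ b ↔ a ≤ lipSub M 0 c := by
  have hc' : 0 < (M - c) / M := div_pos (sub_pos.2 hc) hM
  rw [← sub_nonpos, lipAdd_sub_self hM a b c hc, ← neg_nonneg, ← mul_neg, ← mul_neg, ← neg_div,
    mul_nonneg_iff_of_pos_left (sub_pos.2 hb), mul_nonneg_iff_of_pos_left hc',
    le_div_iff₀ hM, zero_mul, neg_sub, sub_nonneg]

/-- the LIP-additive Asplund distance between f and f ⊞ k is 0:
d(f, f ⊞ k) = c1 ⊟ c2 = 0, where
c1 = inf{ c < M : ∀ h ∈ Db, f(h) ≤ c ⊞ (f ⊞ k)(h) } and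
c2 = sup{ c < M : ∀ h ∈ Db, c ⊞ (f ⊞ k)(h) ≤ f(h) }. -/
theorem aspDist_lipAdd_const_eq_zero (M : ℝ) (hM : 0 < M)
    {G : Type*} [AddCommGroup G] (Db : Finset G) (hne : Db.Nonempty)
    (f : G → ℝ) (hf : ∀ h ∈ Db, f h < M) (k : ℝ) (hk : k < M) :
    let g : G → ℝ := fun h => lipAdd M (f h) k
    let c1 : ℝ := sInf {c | c < M ∧ ∀ h ∈ Db, f h ≤ lipAdd M c (g h)}
    let c2 : ℝ := sSup {c | c < M ∧ ∀ h ∈ Db, lipAdd M c (g h) ≤ f h}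
    lipSub M c1 c2 = 0 := by
  intro g c1 c2
  have hlt := lipSub_zero_lt hM hk
  have h1 : c1 = lipSub M 0 k := by
    have hs : {c | c < M ∧ ∀ h ∈ Db, f h ≤ lipAdd M c (g h)} = Set.Ico (lipSub M 0 k) M := by
      ext c
      refine ⟨fun ⟨hc, h⟩ => ⟨?_, hc⟩, fun ⟨h, hc⟩ => ⟨hc, fun x hx => ?_⟩⟩
      · obtain ⟨x, hx⟩ := hne
        exact (le_lipAdd_lipAdd_iff hM (hf x hx) hk).1 (h x hx)
      · exact (le_lipAdd_lipAdd_iff hM (hf x hx) hk).2 h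
    exact (congrArg sInf hs).trans (csInf_Ico hlt)
  have h2 : c2 = lipSub M 0 k := by
    have hs : {c | c < M ∧ ∀ h ∈ Db, lipAdd M c (g h) ≤ f h} = Set.Iic (lipSub M 0 k) := by
      ext c
      refine ⟨fun ⟨_, h⟩ => ?_, fun h => ⟨lt_of_le_of_lt h hlt, fun x hx => ?_⟩⟩
      · obtain ⟨x, hx⟩ := hne
        exact (lipAdd_lipAdd_le_iff hM (hf x hx) hk).1 (h x hx)
      · exact (lipAdd_lipAdd_le_iff hM (hf x hx) hk).2 h
    exact (congrArg sSup hs).trans csSup_Iic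
  rw [h1, h2, lipSub, sub_self, mul_zero, zero_div]
end

section
/- The LIP-erosion commutes with LIP-addition of a constant: for every constant c < M and every x ∈ G, ε_b(f ⊞ c)(x) = ε_b(f)(x) ⊞ c, where (f ⊞ c)(y) = f(y) ⊞ c pointwise. -/
theorem lipAdd_monotone_left {M c : ℝ} (hM : 0 < M) (hc : c < M) :
    Monotone fun a => lipAdd M a c := by
  intro a a' h
  have hcM : 0 ≤ 1 - c / M := sub_nonneg.2 ((div_le_one hM).2 hc.le)
  have := mul_le_mul_of_nonneg_right h hcM
  simp only [lipAdd, mul_div_assoc]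
  linarith

theorem lipSub_lipAdd_right_comm {M a b c : ℝ} (hM : M ≠ 0) (hb : b < M) :
    lipSub M (lipAdd M a c) b = lipAdd M (lipSub M a b) c := by
  have hMb : M - b ≠ 0 := (sub_pos.2 hb).ne'
  unfold lipSub lipAdd
  field_simp
  ring

/-- the LIP-erosion commutes with LIP-addition of a constant:
ε_b(f ⊞ c)(x) = ε_b(f)(x) ⊞ c. -/
theorem lipErosion_lipAdd_const (M : ℝ) (hM : 0 < M) {G : Type*} [AddCommGroup G]
    (Db : Finset G) (hne : Db.Nonempty) (b : G → ℝ) (hb : ∀ h ∈ Db, b h < M)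
    (f : G → ℝ) (hf : ∀ x, f x < M) (c : ℝ) (hc : c < M) (x : G) :
    lipErosion M Db hne b (fun y => lipAdd M (f y) c) x =
      lipAdd M (lipErosion M Db hne b f x) c := by
  unfold lipErosion
  rw [Finset.apply_inf'_eq_inf'_comp hne (fun a => lipAdd M a c)
    fun _ _ => (lipAdd_monotone_left hM hc).map_inf _ _]
  exact Finset.inf'_congr hne rfl fun h hh => lipSub_lipAdd_right_comm hM.ne' (hb h hh)
end

section
/- The LIP-dilation commutes with LIP-addition of a constant: for every constant c < M and every x ∈ G, δ_b(f ⊞ c)(x) = δ_b(f)(x) ⊞ c, where (f ⊞ c)(y) = f(y) ⊞ c pointwise. -/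
theorem lipAdd_right_comm (M a b c : ℝ) :
    lipAdd M (lipAdd M a b) c = lipAdd M (lipAdd M a c) b := by
  unfold lipAdd
  ring

theorem monotone_lipAdd_const {M c : ℝ} (hM : 0 < M) (hc : c ≤ M) :
    Monotone fun a => lipAdd M a c := by
  intro a a' h
  have hcM : c / M ≤ 1 := (div_le_one hM).2 hc
  simp only [lipAdd, mul_div_assoc]
  nlinarith [mul_nonneg (sub_nonneg.2 h) (sub_nonneg.2 hcM)]

/-- the LIP-dilation commutes with LIP-addition of a constant:
δ_b(f ⊞ c)(x) = δ_b(f)(x) ⊞ c. -/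
theorem lipDilation_lipAdd_const (M : ℝ) (hM : 0 < M) {G : Type*} [AddCommGroup G]
    (Db : Finset G) (hne : Db.Nonempty) (b : G → ℝ) (hb : ∀ h ∈ Db, b h < M)
    (f : G → ℝ) (hf : ∀ x, f x < M) (c : ℝ) (hc : c < M) (x : G) :
    lipDilation M Db hne b (fun y => lipAdd M (f y) c) x =
      lipAdd M (lipDilation M Db hne b f x) c := by
  unfold lipDilation
  rw [Finset.apply_sup'_eq_sup'_comp hne (fun a => lipAdd M a c)
    fun _ _ => (monotone_lipAdd_const hM hc.le).map_sup _ _]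
  exact Finset.sup'_congr hne rfl fun h _ => lipAdd_right_comm M (f (x - h)) c (b h)
end

section
/- (Property 1.) Let b^l be a structuring function with nonempty finite support D_{bl} ⊆ Db and b^l(h) < M for h ∈ D_{bl}. Define the left detector E(b^l, f)(x) = min_{h ∈ D_{bl}} ( f(x+h) ⊟ ( b^l(h) ⊞ ε_b(f)(x) ) ). Then for every x ∈ G, E(b^l, f)(x) = ε_{b^l}(f)(x) ⊟ ε_b(f)(x); i.e., the detector equals the LIP-difference of the two logarithmic erosions. (The same identity holds verbatim for a right element b^r with support D_{br} ⊆ Db.) -/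
theorem lipSub_lipAdd {M b c : ℝ} (a : ℝ) (hM : 0 < M) (hb : b < M) (hc : c < M) :
    lipSub M a (lipAdd M b c) = lipSub M (lipSub M a b) c := by
  have hb' : M - b ≠ 0 := (sub_pos.2 hb).ne'
  have hc' : M - c ≠ 0 := (sub_pos.2 hc).ne'
  have hadd : M - (b + c - b * c / M) = (M - b) * (M - c) / M := by
    field_simp
    ring
  simp only [lipSub, lipAdd]
  rw [hadd]
  field_simp
  ring

theorem monotone_lipSub_left {M c : ℝ} (hM : 0 < M) (hc : c < M) :
    Monotone fun a => lipSub M a c := by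
  intro a a' h
  have hc' : 0 < M - c := sub_pos.2 hc
  simp only [lipSub]
  gcongr

theorem lipErosion_lt {M : ℝ} (hM : 0 < M) {G : Type*} [AddCommGroup G]
    {Da : Finset G} (hne : Da.Nonempty) {a f : G → ℝ} (ha : ∀ h ∈ Da, a h < M)
    (hf : ∀ x, f x < M) (x : G) : lipErosion M Da hne a f x < M := by
  obtain ⟨h, hh⟩ := hne
  exact (Finset.inf'_lt_iff _).2 ⟨h, hh, lipSub_lt hM (hf _) (ha h hh)⟩

/-- Property 1: for a structuring function b^l with nonempty
finite support D_{bl} ⊆ Db and values < M on it, the left detector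
E(b^l, f)(x) = min_{h ∈ D_{bl}} ( f(x+h) ⊟ ( b^l(h) ⊞ ε_b(f)(x) ) )
equals the LIP-difference of the two logarithmic erosions:
E(b^l, f)(x) = ε_{b^l}(f)(x) ⊟ ε_b(f)(x).
(The same identity holds verbatim for a right element b^r.) -/
theorem detector_eq_lipSub_of_lipErosions (M : ℝ) (hM : 0 < M)
    {G : Type*} [AddCommGroup G]
    (Db : Finset G) (hne : Db.Nonempty) (b : G → ℝ) (hb : ∀ h ∈ Db, b h < M)
    (Dbl : Finset G) (hnel : Dbl.Nonempty) (hsub : Dbl ⊆ Db)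
    (bl : G → ℝ) (hbl : ∀ h ∈ Dbl, bl h < M)
    (f : G → ℝ) (hf : ∀ x, f x < M) (x : G) :
    Dbl.inf' hnel
        (fun h => lipSub M (f (x + h))
          (lipAdd M (bl h) (lipErosion M Db hne b f x))) =
      lipSub M (lipErosion M Dbl hnel bl f x) (lipErosion M Db hne b f x) := by
  have hε := lipErosion_lt hM hne hb hf x
  generalize lipErosion M Db hne b f x = ε at hε ⊢
  refine Eq.trans (Finset.inf'_congr hnel rfl fun h hh => lipSub_lipAdd _ hM (hbl h hh) hε) ?_
  exact (Finset.apply_inf'_eq_inf'_comp hnel (fun a => lipSub M a ε)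
    (monotone_lipSub_left hM hε).map_inf).symm
end

section
/- Suppose the structuring function is constant: b(h) = b0 for all h ∈ Db, with b0 < M, and suppose Db is symmetric (−Db = Db). Then for every x ∈ G, the map of LIP-additive Asplund distances equals the LIP-morphological gradient by the flat structuring element with support Db: Asp_b(f)(x) = ( max_{h ∈ Db} f(x+h) ) ⊟ ( min_{h ∈ Db} f(x+h) ) = δ_B(f)(x) ⊟ ε_B(f)(x), where B is the structuring function identically 0 on Db. -/
theorem lipSub_monotone_left {M c : ℝ} (hM : 0 ≤ M) (hc : c ≤ M) :
    Monotone fun a => lipSub M a c := fun a b hab => by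
  have : 0 ≤ M - c := sub_nonneg.2 hc
  change M * (a - c) / (M - c) ≤ M * (b - c) / (M - c)
  gcongr

theorem lipSub_zero_right {M : ℝ} (hM : M ≠ 0) (a : ℝ) : lipSub M a 0 = a := by
  simp [lipSub, hM]

theorem lipAdd_zero_right (M a : ℝ) : lipAdd M a 0 = a := by
  simp [lipAdd]

/-- LIP-subtracting the same grey value from both terms leaves a LIP-difference unchanged. -/
theorem lipSub_lipSub_lipSub_cancel_right {M c : ℝ} (hM : M ≠ 0) (hc : c ≠ M) (a b : ℝ) :
    lipSub M (lipSub M a c) (lipSub M b c) = lipSub M a b := by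
  have hMc : M - c ≠ 0 := sub_ne_zero.2 hc.symm
  have hnum : lipSub M a c - lipSub M b c = M / (M - c) * (a - b) := by
    unfold lipSub; ring
  have hden : M - lipSub M b c = M / (M - c) * (M - b) := by
    unfold lipSub; field_simp; ring
  rw [lipSub, hnum, hden, mul_left_comm, mul_div_mul_left _ _ (div_ne_zero hM hMc), lipSub]

theorem sup'_comp_neg_of_image_neg_eq {G α : Type*} [InvolutiveNeg G] [DecidableEq G]
    [SemilatticeSup α] {s : Finset G} (hs : s.Nonempty)
    (hsym : s.image (fun h => -h) = s) (g : G → α) :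
    (s.sup' hs fun h => g (-h)) = s.sup' hs g := by
  calc (s.sup' hs fun h => g (-h))
      = (s.image fun h => -h).sup' (hs.image _) g := (Finset.sup'_image _ _).symm
    _ = s.sup' hs g := Finset.sup'_congr _ hsym fun _ _ => rfl

/-- for a constant structuring function b ≡ b0 (b0 < M) on a
symmetric support Db (−Db = Db), the map of LIP-additive Asplund distances
equals the LIP-morphological gradient by the flat structuring element B ≡ 0
with support Db:
Asp_b(f)(x) = ( max_{h ∈ Db} f(x+h) ) ⊟ ( min_{h ∈ Db} f(x+h) )
            = δ_B(f)(x) ⊟ ε_B(f)(x). -/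
theorem aspMap_const_probe_eq_lipGradient (M : ℝ) (hM : 0 < M)
    {G : Type*} [AddCommGroup G] [DecidableEq G]
    (Db : Finset G) (hne : Db.Nonempty) (b0 : ℝ) (hb0 : b0 < M)
    (hsym : Db.image (fun h => -h) = Db)
    (f : G → ℝ) (hf : ∀ x, f x < M) (x : G) :
    let b : G → ℝ := fun _ => b0
    let B : G → ℝ := fun _ => 0
    let Asp : ℝ :=
      lipSub M (Db.sup' hne fun h => lipSub M (f (x + h)) (b h))
        (Db.inf' hne fun h => lipSub M (f (x + h)) (b h))
    Asp = lipSub M (Db.sup' hne fun h => f (x + h))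
        (Db.inf' hne fun h => f (x + h)) ∧
    Asp = lipSub M (lipDilation M Db hne B f x) (lipErosion M Db hne B f x) := by
  intro b B Asp
  have hmono := lipSub_monotone_left hM.le hb0.le
  have hgrad : Asp = lipSub M (Db.sup' hne fun h => f (x + h))
      (Db.inf' hne fun h => f (x + h)) := by
    have hsup := Finset.apply_sup'_eq_sup'_comp hne (f := fun h => f (x + h))
      (fun a => lipSub M a b0) hmono.map_sup
    have hinf := Finset.apply_inf'_eq_inf'_comp hne (f := fun h => f (x + h))
      (fun a => lipSub M a b0) hmono.map_inf
    rw [← lipSub_lipSub_lipSub_cancel_right hM.ne' hb0.ne]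
    exact congrArg₂ (lipSub M) hsup.symm hinf.symm
  refine ⟨hgrad, hgrad.trans ?_⟩
  simp only [lipDilation, lipErosion, B, lipAdd_zero_right, lipSub_zero_right hM.ne',
    sub_eq_add_neg]
  rw [sup'_comp_neg_of_image_neg_eq hne hsym fun h => f (x + h)]
end

section
/- Suppose f is constant on the window of x: there is v < M with f(x+h) = v for all h ∈ Db. Then the map of LIP-additive Asplund distances at x equals the LIP-difference of the extrema of the structuring function: Asp_b(f)(x) = b_sup ⊟ b_inf, where b_sup = max_{h ∈ Db} b(h) and b_inf = min_{h ∈ Db} b(h). -/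
/-- The LIP-difference is antitone in its second argument. -/
theorem lipSub_le_lipSub_left {M v s t : ℝ} (hM : 0 < M) (hv : v < M) (ht : t < M)
    (hst : s ≤ t) : lipSub M v t ≤ lipSub M v s := by
  unfold lipSub
  rw [div_le_div_iff₀ (by linarith) (by linarith)]
  nlinarith [mul_nonneg (mul_nonneg hM.le (sub_nonneg.2 hv.le)) (sub_nonneg.2 hst)]

theorem sup'_lipSub {ι : Type*} {M v : ℝ} (hM : 0 < M) (hv : v < M) {D : Finset ι}
    (hne : D.Nonempty) {b : ι → ℝ} (hb : ∀ h ∈ D, b h < M) :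
    (D.sup' hne fun h => lipSub M v (b h)) = lipSub M v (D.inf' hne b) := by
  apply le_antisymm
  · exact Finset.sup'_le _ _ fun h hh =>
      lipSub_le_lipSub_left hM hv (hb h hh) (Finset.inf'_le b hh)
  · obtain ⟨h, hh, he⟩ := Finset.exists_mem_eq_inf' hne b
    rw [he]
    exact Finset.le_sup' (fun h => lipSub M v (b h)) hh

theorem inf'_lipSub {ι : Type*} {M v : ℝ} (hM : 0 < M) (hv : v < M) {D : Finset ι}
    (hne : D.Nonempty) {b : ι → ℝ} (hb : ∀ h ∈ D, b h < M) :
    (D.inf' hne fun h => lipSub M v (b h)) = lipSub M v (D.sup' hne b) := by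
  apply le_antisymm
  · obtain ⟨h, hh, he⟩ := Finset.exists_mem_eq_sup' hne b
    rw [he]
    exact Finset.inf'_le (fun h => lipSub M v (b h)) hh
  · exact Finset.le_inf' _ _ fun h hh =>
      lipSub_le_lipSub_left hM hv ((Finset.sup'_lt_iff hne).2 hb) (Finset.le_sup' b hh)

theorem lipSub_lipSub_lipSub {M v s t : ℝ} (hM : 0 < M) (hv : v < M) (hs : s < M) (ht : t < M) :
    lipSub M (lipSub M v s) (lipSub M v t) = lipSub M t s := by
  have hM' := hM.ne'
  have hv' := (sub_pos.2 hv).ne'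
  have hs' := (sub_pos.2 hs).ne'
  have ht' := (sub_pos.2 ht).ne'
  have hden : M - M * (v - t) / (M - t) = M * (M - v) / (M - t) := by
    field_simp
    ring
  unfold lipSub
  rw [hden]
  field_simp
  ring

/-- if f is constant equal to v < M on the window of x
(f(x+h) = v for all h ∈ Db), then the map of LIP-additive Asplund distances
at x equals the LIP-difference of the extrema of the structuring function:
Asp_b(f)(x) = b_sup ⊟ b_inf, where b_sup = max_{h ∈ Db} b(h) and
b_inf = min_{h ∈ Db} b(h). -/
theorem aspMap_flat_zone (M : ℝ) (hM : 0 < M) {G : Type*} [AddCommGroup G]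
    (Db : Finset G) (hne : Db.Nonempty) (b : G → ℝ) (hb : ∀ h ∈ Db, b h < M)
    (f : G → ℝ) (hf : ∀ x, f x < M) (x : G)
    (v : ℝ) (hv : v < M) (hflat : ∀ h ∈ Db, f (x + h) = v) :
    lipSub M (Db.sup' hne fun h => lipSub M (f (x + h)) (b h))
        (Db.inf' hne fun h => lipSub M (f (x + h)) (b h)) =
      lipSub M (Db.sup' hne b) (Db.inf' hne b) := by
  rw [Finset.sup'_congr hne rfl (fun h hh => by rw [hflat h hh]),
    Finset.inf'_congr hne rfl (fun h hh => by rw [hflat h hh]),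
    sup'_lipSub hM hv hne hb, inf'_lipSub hM hv hne hb]
  exact lipSub_lipSub_lipSub hM hv
    ((Finset.inf'_lt_iff hne).2 (hne.imp fun h hh => ⟨hh, hb h hh⟩))
    ((Finset.sup'_lt_iff hne).2 hb)
end
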